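/- Let Q ∈ L²_loc(ℝ; ℝ) and q = Q'. (a) If y is a solution of L_q y = 0 on ℝ (in the system sense) with y(x) > 0 for all x and y(0) = 1, then the function r := y'/y belongs to L²_loc(ℝ; ℝ) and satisfies the Riccati relation q = B(r), i.e. there is a constant C with r(x) + ∫₀ˣ r(s)² ds = Q(x) + C for almost every x. (b) Conversely, if r ∈ L²_loc(ℝ; ℝ) satisfies the Riccati relation q = B(r), then y(x) := exp(∫₀ˣ r(s) ds) is a strictly positive solution of L_q y = 0 with y(0) = 1. -/

import Mathlib

open MeasureTheory Filter Set intervalIntegral ENNReal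

/-- `Q : ℝ → ℝ` is (real-valued and) locally square integrable on `ℝ`. -/
def LocL2 (Q : ℝ → ℝ) : Prop :=
  Measurable Q ∧ ∀ a b : ℝ, IntegrableOn (fun x => Q x ^ 2) (Set.Icc a b) volume

/-- `y` together with the companion function `u` (representing `u = y' - Q·y`) solves the
first-order system `y' = Q y + u`, `u' = -Q² y - Q u` equivalent to `L_q y = 0` with `q = Q'`,
expressed through integral equations (encoding local absolute continuity). -/
def SolvesWith (Q y u : ℝ → ℝ) : Prop :=
  (∀ x : ℝ, y x = y 0 + ∫ t in (0:ℝ)..x, (Q t * y t + u t)) ∧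
  (∀ x : ℝ, u x = u 0 + ∫ t in (0:ℝ)..x, (-(Q t) ^ 2 * y t - Q t * u t))

/-- `y` solves `L_q y = 0` on `ℝ` in the system sense, `q = Q'`. -/
def Solves (Q y : ℝ → ℝ) : Prop := ∃ u : ℝ → ℝ, SolvesWith Q y u

/-- `L_q ≥ 0` for `q = Q'`: for every real-valued test function `φ`,
`∫ φ'² dx - 2 ∫ Q φ φ' dx ≥ 0` (the second term is the pairing `(q, φ²)`). -/
def LqNonneg (Q : ℝ → ℝ) : Prop :=
  ∀ φ : ℝ → ℝ, ContDiff ℝ (⊤ : ℕ∞) φ → HasCompactSupport φ →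
    0 ≤ (∫ x : ℝ, deriv φ x ^ 2) - 2 * ∫ x : ℝ, Q x * φ x * deriv φ x

/-- The Riccati relation `q = B(r) = r' + r²` for `q = Q'`: there is a constant `C` with
`r x + ∫₀ˣ r² = Q x + C` for almost every `x`. -/
def Riccati (Q r : ℝ → ℝ) : Prop :=
  ∃ C : ℝ, ∀ᵐ x : ℝ ∂volume, r x + (∫ s in (0:ℝ)..x, r s ^ 2) = Q x + C

/-- The function `f` is locally absolutely continuous and its a.e. derivative `f'` is locally
integrable. -/
structure IsPrimitive (f f' : ℝ → ℝ) : Prop where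
  integrable : ∀ a b : ℝ, IntervalIntegrable f' volume a b
  eq_add_integral : ∀ x : ℝ, f x = f 0 + ∫ t in (0:ℝ)..x, f' t

namespace IsPrimitive

variable {f g f' g' : ℝ → ℝ}

lemma sub_eq_integral (hf : IsPrimitive f f') (a b : ℝ) :
    f b - f a = ∫ t in a..b, f' t := by
  rw [hf.eq_add_integral a, hf.eq_add_integral b,
    ← integral_add_adjacent_intervals (hf.integrable 0 a) (hf.integrable a b)]
  ring

lemma absolutelyContinuous (hf : IsPrimitive f f') (a b : ℝ) :
    AbsolutelyContinuousOnInterval f a b := by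
  have h1 : AbsolutelyContinuousOnInterval (fun _ : ℝ => f a) a b :=
    ((LipschitzWith.const (f a)).lipschitzOnWith (s := uIcc a b)).absolutelyContinuousOnInterval
  have h2 := (hf.integrable a b).absolutelyContinuousOnInterval_intervalIntegral
    (c := a) left_mem_uIcc
  convert! h1.add h2 using 1
  ext x
  simp only [Pi.add_apply, ← hf.sub_eq_integral a x]
  ring

lemma continuous (hf : IsPrimitive f f') : Continuous f := by
  have h : f = fun x => f 0 + ∫ t in (0:ℝ)..x, f' t := funext hf.eq_add_integral
  rw [h]
  exact continuous_const.add (intervalIntegral.continuous_primitive hf.integrable 0)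

lemma ae_hasDerivAt (hf : IsPrimitive f f') : ∀ᵐ x : ℝ, HasDerivAt f (f' x) x := by
  have hloc : LocallyIntegrable f' volume := by
    intro x
    refine ⟨Ioc (x - 1) (x + 1), Ioc_mem_nhds (by linarith) (by linarith), ?_⟩
    exact (hf.integrable (x - 1) (x + 1)).1
  filter_upwards [LocallyIntegrable.ae_hasDerivAt_integral hloc] with x hx
  have h : f = fun x => f 0 + ∫ t in (0:ℝ)..x, f' t := funext hf.eq_add_integral
  rw [h]
  exact (hx 0).const_add (f 0)

lemma of_absolutelyContinuous (hf : ∀ a b : ℝ, AbsolutelyContinuousOnInterval f a b)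
    (hd : ∀ᵐ x : ℝ, HasDerivAt f (f' x) x) : IsPrimitive f f' where
  integrable a b := by
    refine (hf a b).intervalIntegrable_deriv.congr_ae (ae_restrict_of_ae ?_)
    filter_upwards [hd] with x hx using hx.deriv
  eq_add_integral x := by
    have h : ∫ t in (0:ℝ)..x, f' t = ∫ t in (0:ℝ)..x, deriv f t := by
      refine integral_congr_ae ?_
      filter_upwards [hd] with x hx _ using hx.deriv.symm
    rw [h, (hf 0 x).integral_deriv_eq_sub]
    ring

lemma of_integrable (hf' : ∀ a b : ℝ, IntervalIntegrable f' volume a b) (C : ℝ) :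
    IsPrimitive (fun x => C + ∫ t in (0:ℝ)..x, f' t) f' where
  integrable := hf'
  eq_add_integral x := by simp

lemma congr_ae (hf : IsPrimitive f f') (h : ∀ᵐ x : ℝ, f' x = g' x) : IsPrimitive f g' where
  integrable a b := (hf.integrable a b).congr_ae (ae_restrict_of_ae h)
  eq_add_integral x := by
    rw [hf.eq_add_integral x]
    congr 1
    exact integral_congr_ae (h.mono fun x hx _ => hx)

lemma mul (hf : IsPrimitive f f') (hg : IsPrimitive g g') :
    IsPrimitive (fun x => f x * g x) (fun x => f' x * g x + f x * g' x) := by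
  refine of_absolutelyContinuous
    (fun a b => (hf.absolutelyContinuous a b).mul (hg.absolutelyContinuous a b)) ?_
  filter_upwards [hf.ae_hasDerivAt, hg.ae_hasDerivAt] with x h1 h2 using h1.mul h2

end IsPrimitive

lemma LipschitzOnWith.comp_absolutelyContinuousOnInterval {F f : ℝ → ℝ} {K : NNReal} {a b : ℝ}
    (hF : LipschitzOnWith K F (f '' uIcc a b)) (hf : AbsolutelyContinuousOnInterval f a b) :
    AbsolutelyContinuousOnInterval (fun x => F (f x)) a b := by
  rw [absolutelyContinuousOnInterval_iff] at hf ⊢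
  intro ε hε
  obtain ⟨δ, hδ, h⟩ := hf (ε / (K + 1)) (by positivity)
  refine ⟨δ, hδ, fun E hE hEδ => ?_⟩
  have hs := h E hE hEδ
  calc
    _ ≤ ∑ i ∈ Finset.range E.1, K * dist (f (E.2 i).1) (f (E.2 i).2) :=
      Finset.sum_le_sum fun i hi => hF.dist_le_mul _ (mem_image_of_mem f (hE.1 i hi).1)
        _ (mem_image_of_mem f (hE.1 i hi).2)
    _ = K * ∑ i ∈ Finset.range E.1, dist (f (E.2 i).1) (f (E.2 i).2) := by
      rw [Finset.mul_sum]
    _ ≤ K * (ε / (K + 1)) := by gcongr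
    _ < (K + 1) * (ε / (K + 1)) := by gcongr; linarith
    _ = ε := by field

lemma IsPrimitive.comp {F F' f f' : ℝ → ℝ} (hf : IsPrimitive f f')
    (hF : ∀ x, ContDiffAt ℝ 1 F (f x)) (hF' : ∀ x, HasDerivAt F (F' (f x)) (f x)) :
    IsPrimitive (fun x => F (f x)) (fun x => F' (f x) * f' x) := by
  refine of_absolutelyContinuous (fun a b => ?_) ?_
  · have hc : Convex ℝ (f '' uIcc a b) :=
      ((isPreconnected_uIcc.image f hf.continuous.continuousOn).ordConnected).convex
    have hk : IsCompact (f '' uIcc a b) := isCompact_uIcc.image hf.continuous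
    have hd : ContDiffOn ℝ 1 F (f '' uIcc a b) := by
      rintro _ ⟨x, -, rfl⟩
      exact (hF x).contDiffWithinAt
    obtain ⟨K, hK⟩ := hd.exists_lipschitzOnWith (by decide) hc hk
    exact hK.comp_absolutelyContinuousOnInterval (hf.absolutelyContinuous a b)
  · filter_upwards [hf.ae_hasDerivAt] with x hx using (hF' x).comp x hx

namespace LocL2

variable {Q : ℝ → ℝ}

lemma intervalIntegrable_sq (hQ : LocL2 Q) (a b : ℝ) :
    IntervalIntegrable (fun x => Q x ^ 2) volume a b :=
  ⟨(hQ.2 a b).mono_set Ioc_subset_Icc_self, (hQ.2 b a).mono_set Ioc_subset_Icc_self⟩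

lemma intervalIntegrable (hQ : LocL2 Q) (a b : ℝ) : IntervalIntegrable Q volume a b := by
  refine ((intervalIntegrable_const (c := (1:ℝ))).add (hQ.intervalIntegrable_sq a b)).mono_fun
    hQ.1.aestronglyMeasurable (Eventually.of_forall fun x => ?_)
  simp only [Real.norm_eq_abs]
  rw [abs_of_nonneg (a := 1 + Q x ^ 2) (by positivity)]
  nlinarith [sq_abs (Q x), sq_nonneg (|Q x| - 1), abs_nonneg (Q x)]

lemma intervalIntegrable_majorant (hQ : LocL2 Q) (a b : ℝ) :
    IntervalIntegrable (fun x => 1 + |Q x| + Q x ^ 2) volume a b :=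
  ((intervalIntegrable_const (c := (1:ℝ))).add (hQ.intervalIntegrable a b).abs).add
    (hQ.intervalIntegrable_sq a b)

lemma comp_neg (hQ : LocL2 Q) : LocL2 (fun x => -Q (-x)) := by
  refine ⟨(hQ.1.comp measurable_neg).neg, fun a b => ?_⟩
  rcases le_or_gt a b with hab | hab
  · have h := (IntervalIntegrable.iff_comp_neg (by simp)).1 (hQ.intervalIntegrable_sq (-a) (-b))
    simp only [neg_neg] at h
    simpa only [neg_sq] using (intervalIntegrable_iff_integrableOn_Icc_of_le hab).1 h
  · simp [Icc_eq_empty_of_lt hab]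

end LocL2

lemma abs_rhs_add_abs_rhs_le (Q y u : ℝ) :
    |Q * y + u| + |-Q ^ 2 * y - Q * u| ≤ (1 + |Q| + Q ^ 2) * (|y| + |u|) := by
  have h1 : |Q * y + u| ≤ |Q| * |y| + |u| := (abs_add_le _ _).trans (by rw [abs_mul])
  have h2 : |-Q ^ 2 * y - Q * u| ≤ Q ^ 2 * |y| + |Q| * |u| :=
    (abs_sub _ _).trans (by rw [abs_mul, abs_mul, abs_neg, abs_sq])
  nlinarith [abs_nonneg y, abs_nonneg u, mul_nonneg (sq_nonneg Q) (abs_nonneg u)]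

/-- Just to the right of any `c`, a function given by a possibly non-convergent integral is
measurable and bounded: either the integral converges past `c`, or the function is constant. -/
lemma exists_gt_aestronglyMeasurable_bounded {z h : ℝ → ℝ}
    (hz : ∀ x : ℝ, z x = z 0 + ∫ t in (0:ℝ)..x, h t) {c : ℝ} (hc : 0 ≤ c) :
    ∃ d > c, AEStronglyMeasurable z (volume.restrict (Ioc c d)) ∧
      ∃ B, ∀ x ∈ Ioc c d, |z x| ≤ B := by
  by_cases H : ∃ d > c, IntervalIntegrable h volume 0 d
  · obtain ⟨d, hd, hi⟩ := H
    have hcont : ContinuousOn z (uIcc 0 d) :=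
      (continuousOn_const.add (continuousOn_primitive_interval' hi left_mem_uIcc)).congr
        fun x _ => hz x
    rw [uIcc_of_le (hc.trans hd.le)] at hcont
    have hsub : Ioc c d ⊆ Icc 0 d := fun x hx => ⟨hc.trans hx.1.le, hx.2⟩
    obtain ⟨B, hB⟩ := isCompact_Icc.exists_bound_of_continuousOn hcont
    exact ⟨d, hd, (hcont.mono hsub).aestronglyMeasurable measurableSet_Ioc, B,
      fun x hx => hB x (hsub hx)⟩
  · push Not at H
    have hconst : ∀ x ∈ Ioc c (c + 1), z x = z 0 := fun x hx => by
      rw [hz x, intervalIntegral.integral_undef (H x hx.1), add_zero]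
    refine ⟨c + 1, by linarith, ?_, |z 0|, fun x hx => (congrArg _ (hconst x hx)).le⟩
    refine (aestronglyMeasurable_const (b := z 0)).congr ?_
    filter_upwards [ae_restrict_mem measurableSet_Ioc] with x hx using (hconst x hx).symm

namespace SolvesWith

variable {Q y u : ℝ → ℝ}

lemma integrableOn_of_bounded (hQ : LocL2 Q) {a b B : ℝ} {s : Set ℝ} (hs : MeasurableSet s)
    (hsub : s ⊆ Icc a b)
    (hym : AEStronglyMeasurable y (volume.restrict s))
    (hum : AEStronglyMeasurable u (volume.restrict s))
    (hy : ∀ x ∈ s, |y x| ≤ B) (hu : ∀ x ∈ s, |u x| ≤ B) :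
    IntegrableOn (fun t => Q t * y t + u t) s ∧
      IntegrableOn (fun t => -(Q t) ^ 2 * y t - Q t * u t) s := by
  have hk : IntegrableOn (fun x => (1 + |Q x| + Q x ^ 2) * (B + B)) s := by
    rcases le_or_gt a b with hab | hab
    · exact (((intervalIntegrable_iff_integrableOn_Icc_of_le hab).1
        (hQ.intervalIntegrable_majorant a b)).mono_set hsub).mul_const _
    · rw [Icc_eq_empty_of_lt hab, subset_empty_iff] at hsub
      simp [hsub]
  have hQm : AEStronglyMeasurable Q (volume.restrict s) := hQ.1.aestronglyMeasurable
  have key : ∀ x ∈ s, |Q x * y x + u x| + |-(Q x) ^ 2 * y x - Q x * u x| ≤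
      (1 + |Q x| + Q x ^ 2) * (B + B) := fun x hx =>
    (abs_rhs_add_abs_rhs_le _ _ _).trans
      (mul_le_mul_of_nonneg_left (add_le_add (hy x hx) (hu x hx)) (by positivity))
  constructor
  · refine Integrable.mono' hk ((hQm.mul hym).add hum) ?_
    filter_upwards [ae_restrict_mem hs] with x hx
    exact (le_add_of_nonneg_right (abs_nonneg _)).trans (key x hx)
  · refine Integrable.mono' hk (((hQm.pow 2).neg.mul hym).sub (hQm.mul hum)) ?_
    filter_upwards [ae_restrict_mem hs] with x hx
    exact (le_add_of_nonneg_left (abs_nonneg _)).trans (key x hx)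

/-- The right-hand sides of the first-order system are integrable on `[0, x]`. -/
def IntegrableUpTo (Q y u : ℝ → ℝ) (x : ℝ) : Prop :=
  IntervalIntegrable (fun t => Q t * y t + u t) volume 0 x ∧
    IntervalIntegrable (fun t => -(Q t) ^ 2 * y t - Q t * u t) volume 0 x

lemma IntegrableUpTo.mono {a b : ℝ} (h : IntegrableUpTo Q y u b) (ha : 0 ≤ a) (hab : a ≤ b) :
    IntegrableUpTo Q y u a := by
  have hsub : uIcc 0 a ⊆ uIcc 0 b := by
    rw [uIcc_of_le ha, uIcc_of_le (ha.trans hab)]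
    exact Icc_subset_Icc_right hab
  exact ⟨h.1.mono_set hsub, h.2.mono_set hsub⟩

lemma continuousOn (hS : SolvesWith Q y u) {x : ℝ} (hx : 0 ≤ x) (h : IntegrableUpTo Q y u x) :
    ContinuousOn y (Icc 0 x) ∧ ContinuousOn u (Icc 0 x) := by
  rw [← uIcc_of_le hx]
  exact ⟨(continuousOn_const.add (continuousOn_primitive_interval' h.1 left_mem_uIcc)).congr
      fun x _ => hS.1 x,
    (continuousOn_const.add (continuousOn_primitive_interval' h.2 left_mem_uIcc)).congr
      fun x _ => hS.2 x⟩

lemma abs_add_abs_le_integral (hQ : LocL2 Q) (hS : SolvesWith Q y u) {d m M : ℝ} (hd : 0 ≤ d)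
    (hdm : d ≤ m) (h : IntegrableUpTo Q y u m) (hM : ∀ x ∈ Icc d m, |y x| + |u x| ≤ M) :
    |y m| + |u m| ≤ |y d| + |u d| + (∫ t in d..m, (1 + |Q t| + Q t ^ 2)) * M := by
  have hd' := h.mono hd hdm
  have hf := hd'.1.symm.trans h.1
  have hg := hd'.2.symm.trans h.2
  have ey : y m = y d + ∫ t in d..m, (Q t * y t + u t) := by
    rw [hS.1 m, hS.1 d, ← integral_add_adjacent_intervals hd'.1 hf]; ring
  have eu : u m = u d + ∫ t in d..m, (-(Q t) ^ 2 * y t - Q t * u t) := by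
    rw [hS.2 m, hS.2 d, ← integral_add_adjacent_intervals hd'.2 hg]; ring
  have hy : |y m| ≤ |y d| + ∫ t in d..m, |Q t * y t + u t| := by
    rw [ey]
    exact (abs_add_le _ _).trans (add_le_add_right (abs_integral_le_integral_abs hdm) _)
  have hu : |u m| ≤ |u d| + ∫ t in d..m, |-(Q t) ^ 2 * y t - Q t * u t| := by
    rw [eu]
    exact (abs_add_le _ _).trans (add_le_add_right (abs_integral_le_integral_abs hdm) _)
  have hle : (∫ t in d..m, |Q t * y t + u t|) + (∫ t in d..m, |-(Q t) ^ 2 * y t - Q t * u t|) ≤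
      (∫ t in d..m, (1 + |Q t| + Q t ^ 2)) * M := by
    rw [← intervalIntegral.integral_add hf.abs hg.abs, ← intervalIntegral.integral_mul_const]
    refine integral_mono_on hdm (hf.abs.add hg.abs)
      ((hQ.intervalIntegrable_majorant d m).mul_const M) fun x hx => ?_
    exact (abs_rhs_add_abs_rhs_le _ _ _).trans
      (mul_le_mul_of_nonneg_left (hM x hx) (by positivity))
  linarith

lemma exists_bound_Ico (hQ : LocL2 Q) (hS : SolvesWith Q y u) {c : ℝ} (hc : 0 < c)
    (h : ∀ x ∈ Ico 0 c, IntegrableUpTo Q y u x) :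
    ∃ B, ∀ x ∈ Ico 0 c, |y x| + |u x| ≤ B := by
  have hcont := intervalIntegral.continuous_primitive hQ.intervalIntegrable_majorant 0
  have hev : ∀ᶠ x in nhdsWithin c (Iio c),
      (∫ t in (0:ℝ)..c, (1 + |Q t| + Q t ^ 2)) - 1 / 2 <
        ∫ t in (0:ℝ)..x, (1 + |Q t| + Q t ^ 2) :=
    (hcont.tendsto c).mono_left nhdsWithin_le_nhds |>.eventually (lt_mem_nhds (by linarith))
  obtain ⟨d, hd, hd0, hdc⟩ := (hev.and (Ioo_mem_nhdsLT hc)).exists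
  have hcd : ContinuousOn (fun x => |y x| + |u x|) (Icc 0 d) :=
    let hh := hS.continuousOn hd0.le (h d ⟨hd0.le, hdc⟩)
    hh.1.abs.add hh.2.abs
  obtain ⟨B, hB⟩ := isCompact_Icc.exists_bound_of_continuousOn hcd
  refine ⟨max B (2 * (|y d| + |u d|)), fun x hx => ?_⟩
  rcases le_or_gt x d with hxd | hxd
  · exact ((le_abs_self _).trans (hB x ⟨hx.1, hxd⟩)).trans (le_max_left _ _)
  · refine le_max_of_le_right ?_
    have hcx : ContinuousOn (fun x => |y x| + |u x|) (Icc d x) :=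
      let hh := hS.continuousOn hx.1 (h x hx)
      (hh.1.abs.add hh.2.abs).mono (Icc_subset_Icc_left hd0.le)
    obtain ⟨m, hm, hmax⟩ := isCompact_Icc.exists_isMaxOn (nonempty_Icc.2 hxd.le) hcx
    have hmc : m < c := hm.2.trans_lt hx.2
    have hle := abs_add_abs_le_integral hQ hS hd0.le hm.1 (h m ⟨hd0.le.trans hm.1, hmc⟩)
      (M := |y m| + |u m|) fun t ht => hmax ⟨ht.1, ht.2.trans hm.2⟩
    have hsmall : ∫ t in d..m, (1 + |Q t| + Q t ^ 2) ≤ 1 / 2 := by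
      have e1 := integral_add_adjacent_intervals (hQ.intervalIntegrable_majorant 0 d)
        (hQ.intervalIntegrable_majorant d m)
      have e2 := integral_add_adjacent_intervals (hQ.intervalIntegrable_majorant 0 m)
        (hQ.intervalIntegrable_majorant m c)
      have e3 : 0 ≤ ∫ t in m..c, (1 + |Q t| + Q t ^ 2) :=
        integral_nonneg hmc.le fun t _ => by positivity
      linarith
    have hxm : |y x| + |u x| ≤ |y m| + |u m| := hmax ⟨hxd.le, le_rfl⟩
    nlinarith [mul_le_mul_of_nonneg_right hsmall
      (add_nonneg (abs_nonneg (y m)) (abs_nonneg (u m)))]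

lemma integrableUpTo_of_forall_lt (hQ : LocL2 Q) (hS : SolvesWith Q y u) {c : ℝ} (hc : 0 ≤ c)
    (h : ∀ x ∈ Ico 0 c, IntegrableUpTo Q y u x) : IntegrableUpTo Q y u c := by
  rcases hc.eq_or_lt with rfl | hc0
  · exact ⟨IntervalIntegrable.refl, IntervalIntegrable.refl⟩
  obtain ⟨B, hB⟩ := exists_bound_Ico hQ hS hc0 h
  have hcont : ContinuousOn y (Ico 0 c) ∧ ContinuousOn u (Ico 0 c) := by
    have key : ∀ x ∈ Ico 0 c, ContinuousWithinAt y (Ico 0 c) x ∧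
        ContinuousWithinAt u (Ico 0 c) x := fun x hx => by
      obtain ⟨e, hxe, hec⟩ := exists_between hx.2
      have he0 := hx.1.trans hxe.le
      have hh := hS.continuousOn he0 (h e ⟨he0, hec⟩)
      have hmem : Icc 0 e ∈ nhdsWithin x (Ico 0 c) := by
        filter_upwards [self_mem_nhdsWithin, mem_nhdsWithin_of_mem_nhds (Iic_mem_nhds hxe)]
          with t ht ht' using ⟨ht.1, ht'⟩
      exact ⟨(hh.1 x ⟨hx.1, hxe.le⟩).mono_of_mem_nhdsWithin hmem,
        (hh.2 x ⟨hx.1, hxe.le⟩).mono_of_mem_nhdsWithin hmem⟩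
    exact ⟨fun x hx => (key x hx).1, fun x hx => (key x hx).2⟩
  have hint := integrableOn_of_bounded hQ measurableSet_Ico Ico_subset_Icc_self
    (hcont.1.aestronglyMeasurable measurableSet_Ico)
    (hcont.2.aestronglyMeasurable measurableSet_Ico)
    (fun x hx => (le_add_of_nonneg_right (abs_nonneg _)).trans (hB x hx))
    (fun x hx => (le_add_of_nonneg_left (abs_nonneg _)).trans (hB x hx))
  exact ⟨(intervalIntegrable_iff_integrableOn_Ico_of_le hc).2 hint.1,
    (intervalIntegrable_iff_integrableOn_Ico_of_le hc).2 hint.2⟩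

lemma exists_gt_integrableUpTo (hQ : LocL2 Q) (hS : SolvesWith Q y u) {c : ℝ} (hc : 0 ≤ c)
    (h : IntegrableUpTo Q y u c) : ∃ d > c, IntegrableUpTo Q y u d := by
  obtain ⟨d₁, hd₁, hym, B₁, hB₁⟩ := exists_gt_aestronglyMeasurable_bounded hS.1 hc
  obtain ⟨d₂, hd₂, hum, B₂, hB₂⟩ := exists_gt_aestronglyMeasurable_bounded hS.2 hc
  have hs₁ : Ioc c (min d₁ d₂) ⊆ Ioc c d₁ := Ioc_subset_Ioc_right (min_le_left _ _)
  have hs₂ : Ioc c (min d₁ d₂) ⊆ Ioc c d₂ := Ioc_subset_Ioc_right (min_le_right _ _)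
  have hd : c < min d₁ d₂ := lt_min hd₁ hd₂
  have hint := integrableOn_of_bounded (B := max B₁ B₂) hQ measurableSet_Ioc Ioc_subset_Icc_self
    (hym.mono_measure (Measure.restrict_mono hs₁ le_rfl))
    (hum.mono_measure (Measure.restrict_mono hs₂ le_rfl))
    (fun x hx => (hB₁ x (hs₁ hx)).trans (le_max_left _ _))
    (fun x hx => (hB₂ x (hs₂ hx)).trans (le_max_right _ _))
  exact ⟨min d₁ d₂, hd,
    h.1.trans ((intervalIntegrable_iff_integrableOn_Ioc_of_le hd.le).2 hint.1),
    h.2.trans ((intervalIntegrable_iff_integrableOn_Ioc_of_le hd.le).2 hint.2)⟩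

lemma integrableUpTo_of_nonneg (hQ : LocL2 Q) (hS : SolvesWith Q y u) {x : ℝ} (hx : 0 ≤ x) :
    IntegrableUpTo Q y u x := by
  by_contra hxn
  set K : Set ℝ := {t | 0 ≤ t ∧ IntegrableUpTo Q y u t}
  have h0 : (0:ℝ) ∈ K := ⟨le_rfl, IntervalIntegrable.refl, IntervalIntegrable.refl⟩
  have hbdd : BddAbove K := ⟨x, fun t ht => by
    by_contra hlt
    exact hxn (ht.2.mono hx (not_le.1 hlt).le)⟩
  have hc : 0 ≤ sSup K := le_csSup hbdd h0
  have hcK : IntegrableUpTo Q y u (sSup K) :=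
    integrableUpTo_of_forall_lt hQ hS hc fun t ht => by
    obtain ⟨s, hs, hts⟩ := exists_lt_of_lt_csSup ⟨0, h0⟩ ht.2
    exact hs.2.mono ht.1 hts.le
  obtain ⟨d, hd, hdK⟩ := exists_gt_integrableUpTo hQ hS hc hcK
  exact (le_csSup hbdd ⟨hc.trans hd.le, hdK⟩).not_gt hd

lemma comp_neg (hS : SolvesWith Q y u) :
    SolvesWith (fun x => -Q (-x)) (fun x => y (-x)) (fun x => -u (-x)) := by
  refine ⟨fun x => ?_, fun x => ?_⟩
  · have h : ∫ t in (0:ℝ)..(-x), (Q t * y t + u t) =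
        -∫ t in (0:ℝ)..x, (Q (-t) * y (-t) + u (-t)) := by
      rw [integral_comp_neg (fun t => Q t * y t + u t), neg_zero, ← integral_symm]
    simp only [neg_zero]
    rw [hS.1 (-x), h, ← intervalIntegral.integral_neg]
    congr 2
    ext t
    ring
  · have h : ∫ t in (0:ℝ)..(-x), (-(Q t) ^ 2 * y t - Q t * u t) =
        -∫ t in (0:ℝ)..x, (-(Q (-t)) ^ 2 * y (-t) - Q (-t) * u (-t)) := by
      rw [integral_comp_neg (fun t => -(Q t) ^ 2 * y t - Q t * u t), neg_zero, ← integral_symm]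
    simp only [neg_zero]
    rw [hS.2 (-x), h, neg_add, neg_neg]
    congr 2
    ext t
    ring

lemma integrableUpTo (hQ : LocL2 Q) (hS : SolvesWith Q y u) (x : ℝ) :
    IntegrableUpTo Q y u x := by
  rcases le_total 0 x with hx | hx
  · exact integrableUpTo_of_nonneg hQ hS hx
  · have h := integrableUpTo_of_nonneg hQ.comp_neg hS.comp_neg (neg_nonneg.2 hx)
    have h1 := ((IntervalIntegrable.iff_comp_neg (by simp)).1 h.1).neg
    have h2 := (IntervalIntegrable.iff_comp_neg (by simp)).1 h.2
    simp only [neg_neg, neg_zero] at h1 h2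
    constructor
    · convert! h1 using 1
      ext t
      simp only [Pi.neg_apply]
      ring
    · convert! h2 using 1
      ext t
      ring

lemma isPrimitive (hQ : LocL2 Q) (hS : SolvesWith Q y u) :
    IsPrimitive y (fun t => Q t * y t + u t) ∧
      IsPrimitive u (fun t => -(Q t) ^ 2 * y t - Q t * u t) :=
  ⟨⟨fun a b => (integrableUpTo hQ hS a).1.symm.trans (integrableUpTo hQ hS b).1, hS.1⟩,
    ⟨fun a b => (integrableUpTo hQ hS a).2.symm.trans (integrableUpTo hQ hS b).2, hS.2⟩⟩

lemma isPrimitive_div (hQ : LocL2 Q) (hS : SolvesWith Q y u) (hy : ∀ x, 0 < y x) :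
    IsPrimitive (fun x => u x / y x) (fun x => -((Q x * y x + u x) / y x) ^ 2) := by
  obtain ⟨hyp, hup⟩ := isPrimitive hQ hS
  have hinv := hyp.comp (F := fun t => t⁻¹) (F' := fun t => -(t ^ 2)⁻¹)
    (fun x => contDiffAt_inv ℝ (hy x).ne') (fun x => hasDerivAt_inv (hy x).ne')
  refine (hup.mul hinv).congr_ae (Eventually.of_forall fun x => ?_)
  have := (hy x).ne'
  field

lemma locL2_logDeriv (hQ : LocL2 Q) (hS : SolvesWith Q y u) (hy : ∀ x, 0 < y x) :
    LocL2 (fun x => (Q x * y x + u x) / y x) := by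
  obtain ⟨hyp, hup⟩ := isPrimitive hQ hS
  refine ⟨((hQ.1.mul hyp.continuous.measurable).add hup.continuous.measurable).div
    hyp.continuous.measurable, fun a b => ?_⟩
  rcases le_or_gt a b with hab | hab
  · have h := ((isPrimitive_div hQ hS hy).integrable a b).neg
    simpa only [Pi.neg_def, neg_neg] using (intervalIntegrable_iff_integrableOn_Icc_of_le hab).1 h
  · simp [Icc_eq_empty_of_lt hab]

lemma riccati_logDeriv (hQ : LocL2 Q) (hS : SolvesWith Q y u) (hy : ∀ x, 0 < y x) :
    Riccati Q (fun x => (Q x * y x + u x) / y x) := by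
  refine ⟨u 0 / y 0, Eventually.of_forall fun x => ?_⟩
  have h := (isPrimitive_div hQ hS hy).eq_add_integral x
  rw [intervalIntegral.integral_neg] at h
  have hxy : (Q x * y x + u x) / y x = Q x + u x / y x := by
    have := (hy x).ne'
    field
  simp only at h ⊢
  rw [hxy]
  linarith

end SolvesWith

lemma Riccati.solves_exp {Q r : ℝ → ℝ} (hr : LocL2 r) (h : Riccati Q r) :
    Solves Q (fun x => Real.exp (∫ s in (0:ℝ)..x, r s)) := by
  obtain ⟨C, hC⟩ := h
  have hR : IsPrimitive (fun x => ∫ s in (0:ℝ)..x, r s) r := by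
    simpa using IsPrimitive.of_integrable hr.intervalIntegrable 0
  have hy := hR.comp (F := Real.exp) (F' := Real.exp) (fun x => Real.contDiff_exp.contDiffAt)
    (fun x => Real.hasDerivAt_exp _)
  have hw := IsPrimitive.of_integrable (fun a b => (hr.intervalIntegrable_sq a b).neg) C
  have hu := hw.mul hy
  refine ⟨_, (hy.congr_ae ?_).eq_add_integral, (hu.congr_ae ?_).eq_add_integral⟩
  all_goals
    filter_upwards [hC] with x hx
    have hQx : Q x = r x + (∫ s in (0:ℝ)..x, r s ^ 2) - C := by linarith
    simp only [Pi.neg_apply, intervalIntegral.integral_neg, hQx]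
    ring

/-- **Lemma (positive solutions and the Miura map).**
(a) If `y` is a strictly positive solution of `L_q y = 0` with `y 0 = 1` (system sense, with
companion `u`, so that `y' = Q y + u` a.e.), then `r := y'/y = (Q y + u)/y` belongs to
`L²_loc(ℝ)` and satisfies the Riccati relation `q = B(r)`.
(b) Conversely, if `r ∈ L²_loc(ℝ)` satisfies `q = B(r)`, then `y x = exp(∫₀ˣ r)` is a strictly
positive solution of `L_q y = 0` with `y 0 = 1`. -/
theorem positive_solutions_and_miura (Q : ℝ → ℝ) (hQ : LocL2 Q) :
    (∀ y u : ℝ → ℝ, SolvesWith Q y u → (∀ x : ℝ, 0 < y x) → y 0 = 1 →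
      LocL2 (fun x => (Q x * y x + u x) / y x) ∧
      Riccati Q (fun x => (Q x * y x + u x) / y x)) ∧
    (∀ r : ℝ → ℝ, LocL2 r → Riccati Q r →
      Solves Q (fun x => Real.exp (∫ s in (0:ℝ)..x, r s)) ∧
      (∀ x : ℝ, 0 < Real.exp (∫ s in (0:ℝ)..x, r s)) ∧
      Real.exp (∫ s in (0:ℝ)..(0:ℝ), r s) = 1) := by
  exact ⟨fun y u hS hy _ => ⟨hS.locL2_logDeriv hQ hy, hS.riccati_logDeriv hQ hy⟩,
    fun r hr h => ⟨h.solves_exp hr, fun x => Real.exp_pos _, by simp⟩⟩
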